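/- There exists a constant C such that for every positive integer m there exists a triangle-free graph H_m with at most C·m^4·(1 + log m)^2 vertices satisfying χ(H_m) = χ_f(H_m) = m. -/

import Mathlib

open SimpleGraph

/-- An `(a : b)`-coloring of `G`: each vertex gets a `b`-element subset of
`{1, …, a}`, with adjacent vertices receiving disjoint sets. -/
def HasFracColoring {W : Type*} (G : SimpleGraph W) (a b : ℕ) : Prop :=
  ∃ f : W → Finset (Fin a), (∀ w, (f w).card = b) ∧
    ∀ ⦃x y⦄, G.Adj x y → Disjoint (f x) (f y)

/-- The fractional chromatic number. -/
noncomputable def fracChrom {W : Type*} (G : SimpleGraph W) : ℝ :=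
  sInf {q : ℝ | ∃ a b : ℕ, 0 < b ∧ HasFracColoring G a b ∧ q = (a : ℝ) / (b : ℝ)}


/-- Finite set version of independence. -/
def IndepFin {U : Type*} (G : SimpleGraph U) (S : Finset U) : Prop :=
  ∀ x ∈ S, ∀ y ∈ S, ¬ G.Adj x y

theorem frac_lower {n m : ℕ} (hn : 0 < n) (H : SimpleGraph (Fin n))
    (hind : ∀ S : Finset (Fin n), IndepFin H S → m * S.card ≤ n)
    {a b : ℕ} (h : HasFracColoring H a b) : m * b ≤ a := by
  classical
  obtain ⟨f, hf, hd⟩ := h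
  have h1 : ∑ w : Fin n, (f w).card = n * b := by simp [hf]
  have h2 : ∑ w : Fin n, (f w).card
      = ∑ c : Fin a, (Finset.univ.filter (fun w => c ∈ f w)).card := by
    simp_rw [Finset.card_filter]
    rw [Finset.sum_comm]
    refine Finset.sum_congr rfl fun w _ => ?_
    simp
  have h3 : ∑ c : Fin a, m * (Finset.univ.filter (fun w => c ∈ f w)).card
      ≤ ∑ c : Fin a, n := by
    refine Finset.sum_le_sum fun c _ => hind _ ?_
    intro x hx y hy hxy
    simp only [Finset.mem_filter, Finset.mem_univ, true_and] at hx hy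
    exact (Finset.disjoint_left.1 (hd hxy)) hx hy
  rw [← Finset.mul_sum, ← h2, h1] at h3
  simp only [Finset.sum_const, Finset.card_univ, Fintype.card_fin, smul_eq_mul] at h3
  have : n * (m * b) ≤ n * a := by nlinarith
  exact Nat.le_of_mul_le_mul_left this hn

theorem frac_of_colorable {n k : ℕ} (H : SimpleGraph (Fin n)) (h : H.Colorable k) :
    HasFracColoring H k 1 := by
  obtain ⟨c⟩ := h
  refine ⟨fun v => {c v}, by simp, fun x y hxy => ?_⟩
  simpa using c.valid hxy

theorem finish {n m : ℕ} (hn : 0 < n) (H : SimpleGraph (Fin n))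
    (hind : ∀ S : Finset (Fin n), IndepFin H S → m * S.card ≤ n)
    (hc : H.Colorable m) : H.chromaticNumber = m ∧ fracChrom H = (m : ℝ) := by
  constructor
  · apply le_antisymm
    · exact hc.chromaticNumber_le
    · rw [SimpleGraph.le_chromaticNumber_iff_colorable]
      intro k hk
      have := frac_lower hn H hind (frac_of_colorable H hk)
      omega
  · have : IsLeast {q : ℝ | ∃ a b : ℕ, 0 < b ∧ HasFracColoring H a b ∧ q = (a : ℝ) / (b : ℝ)}
        (m : ℝ) := by
      constructor
      · exact ⟨m, 1, one_pos, frac_of_colorable H hc, by simp⟩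
      · rintro q ⟨a, b, hb, h, rfl⟩
        have := frac_lower hn H hind h
        rw [le_div_iff₀ (by exact_mod_cast hb)]
        exact_mod_cast this
    exact this.csInf_eq

/-- Tensor product with a complete graph. -/
def tensorK {V : Type*} (G : SimpleGraph V) (m : ℕ) : SimpleGraph (V × Fin m) where
  Adj p q := G.Adj p.1 q.1 ∧ p.2 ≠ q.2
  symm := ⟨fun _ _ h => ⟨h.1.symm, h.2.symm⟩⟩
  loopless := ⟨fun p h => h.2 rfl⟩

open Classical in
theorem exists_expanding {V : Type*} [Fintype V] [Nonempty V] (G : SimpleGraph V) (m : ℕ)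
    (h : ∀ A : Finset V, IndepFin G A → m * A.card ≤ Fintype.card V) :
    ∃ W : Finset V, W.Nonempty ∧ ∀ A ⊆ W, IndepFin G A →
      m * A.card ≤ A.card + (W.filter (fun v => ∃ u ∈ A, G.Adj u v)).card := by
  let P : Finset V → Prop := fun W => W.Nonempty ∧ ∀ A ⊆ W, IndepFin G A → m * A.card ≤ W.card
  have hP : ∃ W, P W := ⟨Finset.univ, Finset.univ_nonempty, fun A _ hA => by
    simpa using h A hA⟩
  obtain ⟨W, ⟨hWn, hW⟩, hmin⟩ := exists_minimal_of_wellFoundedLT P hP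
  refine ⟨W, hWn, fun A hAW hA => ?_⟩
  by_contra hlt
  push Not at hlt
  set N := W.filter (fun v => ∃ u ∈ A, G.Adj u v) with hN
  have hAN : Disjoint A N := by
    rw [Finset.disjoint_left]
    intro v hv hvN
    obtain ⟨_, u, hu, huv⟩ := Finset.mem_filter.1 hvN
    exact hA u hu v hv huv
  have hsub : A ∪ N ⊆ W := Finset.union_subset hAW (Finset.filter_subset _ _)
  have hcard : (W \ (A ∪ N)).card + (A.card + N.card) = W.card := by
    rw [← Finset.card_union_of_disjoint hAN]
    exact Finset.card_sdiff_add_card_eq_card hsub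
  have hA1 := hW A hAW hA
  have hAne : A.Nonempty := by
    rw [Finset.nonempty_iff_ne_empty]
    rintro rfl
    simp at hlt
  have hPW : P (W \ (A ∪ N)) := by
    constructor
    · rw [← Finset.card_pos]; omega
    · intro B hB hBi
      have hBA : Disjoint A B := by
        rw [Finset.disjoint_left]
        intro v hv hvB
        have := hB hvB
        simp [hv] at this
      have hno : ∀ x ∈ A, ∀ y ∈ B, ¬ G.Adj x y := by
        intro x hx y hy hxy
        have := Finset.mem_sdiff.1 (hB hy)
        exact this.2 (Finset.mem_union_right _ (Finset.mem_filter.2 ⟨this.1, x, hx, hxy⟩))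
      have := hW (A ∪ B) (Finset.union_subset hAW (hB.trans Finset.sdiff_subset)) (by
        intro x hx y hy
        rcases Finset.mem_union.1 hx with hx | hx <;> rcases Finset.mem_union.1 hy with hy | hy
        · exact hA x hx y hy
        · exact hno x hx y hy
        · exact fun h => hno y hy x hx h.symm
        · exact hBi x hx y hy)
      rw [Finset.card_union_of_disjoint hBA, mul_add] at this
      omega
  have hle : W ⊆ W \ (A ∪ N) := hmin hPW Finset.sdiff_subset
  obtain ⟨v, hv⟩ := hAne
  have := hle (hAW hv)
  simp [hv] at this

open Classical in
theorem tensor_indep {V : Type*} (G : SimpleGraph V) (m : ℕ) (W : Finset V)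
    (h : ∀ A ⊆ W, IndepFin G A →
      m * A.card ≤ A.card + (W.filter (fun v => ∃ u ∈ A, G.Adj u v)).card)
    (S : Finset (V × Fin m)) (hSW : ∀ p ∈ S, p.1 ∈ W) (hS : IndepFin (tensorK G m) S) :
    S.card ≤ W.card := by
  let s : V → Finset (V × Fin m) := fun u => S.filter (fun p => p.1 = u)
  have hs : S.card = ∑ u ∈ W, (s u).card :=
    Finset.card_eq_sum_card_fiberwise (fun p hp => hSW p hp)
  have hsm : ∀ u, (s u).card ≤ m := by
    intro u
    have : (s u).card ≤ (Finset.univ : Finset (Fin m)).card := by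
      apply Finset.card_le_card_of_injOn Prod.snd (by simp)
      intro p hp q hq hpq
      have hp' := (Finset.mem_filter.1 hp).2
      have hq' := (Finset.mem_filter.1 hq).2
      exact Prod.ext (hp'.trans hq'.symm) hpq
    simpa using this
  let A := W.filter (fun u => 1 < (s u).card)
  have hzero : ∀ u ∈ A, ∀ v, G.Adj u v → (s v).card = 0 := by
    intro u hu v huv
    by_contra hne
    obtain ⟨p, hp⟩ := Finset.card_pos.1 (Nat.pos_of_ne_zero hne)
    obtain ⟨x, hx, y, hy, hxy⟩ := Finset.one_lt_card.1 (Finset.mem_filter.1 hu).2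
    obtain ⟨hpS, hpv⟩ := Finset.mem_filter.1 hp
    obtain ⟨hxS, hxu⟩ := Finset.mem_filter.1 hx
    obtain ⟨hyS, hyu⟩ := Finset.mem_filter.1 hy
    have h1 : x.2 = p.2 := by
      by_contra hn
      exact hS x hxS p hpS ⟨by rw [hxu, hpv]; exact huv, hn⟩
    have h2 : y.2 = p.2 := by
      by_contra hn
      exact hS y hyS p hpS ⟨by rw [hyu, hpv]; exact huv, hn⟩
    exact hxy (Prod.ext (hxu.trans hyu.symm) (h1.trans h2.symm))
  have hAi : IndepFin G A := by
    intro u hu v hv huv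
    have h1 := hzero u hu v huv
    have h2 := (Finset.mem_filter.1 hv).2
    omega
  have hA := h A (Finset.filter_subset _ _) hAi
  set N := W.filter (fun v => ∃ u ∈ A, G.Adj u v) with hN
  have key : ∑ u ∈ W, ((s u).card + (if u ∈ A then 1 else 0) + (if u ∈ N then 1 else 0))
      ≤ ∑ u ∈ W, ((if u ∈ A then m else 0) + 1) := by
    refine Finset.sum_le_sum fun u hu => ?_
    have hmu := hsm u
    by_cases huN : u ∈ N
    · obtain ⟨_, v, hv, hvu⟩ := Finset.mem_filter.1 huN
      have h0 := hzero v hv u hvu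
      have hnA : u ∉ A := fun hA' => by
        have := (Finset.mem_filter.1 hA').2
        omega
      simp [huN, hnA, h0]
    · by_cases huA : u ∈ A
      · simp [huN, huA, hmu]
      · have : ¬ 1 < (s u).card := fun hh => huA (Finset.mem_filter.2 ⟨hu, hh⟩)
        simp only [huN, huA, if_false]
        omega
  have e1 : ∑ u ∈ W, (if u ∈ A then 1 else 0) = A.card := by
    rw [← Finset.card_filter, Finset.filter_mem_eq_inter,
      Finset.inter_eq_right.2 (Finset.filter_subset _ _)]
  have e2 : ∑ u ∈ W, (if u ∈ N then 1 else 0) = N.card := by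
    rw [← Finset.card_filter, Finset.filter_mem_eq_inter,
      Finset.inter_eq_right.2 (Finset.filter_subset _ _)]
  have e3 : ∑ u ∈ W, (if u ∈ A then m else 0) = m * A.card := by
    rw [← e1, Finset.mul_sum]
    refine Finset.sum_congr rfl fun u _ => ?_
    split_ifs <;> simp
  rw [Finset.sum_add_distrib, Finset.sum_add_distrib, Finset.sum_add_distrib, e1, e2, e3, ← hs]
    at key
  simp only [Finset.sum_const, smul_eq_mul, mul_one] at key
  omega

/-- Orientation of the flag graph: a flag `(x, a, b)` is the point `(x, a x + b)` on the line
`y = a x + b`. -/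
def flagRel (q : ℕ) (e f : ZMod q × ZMod q × ZMod q) : Prop :=
  e.1.val < f.1.val ∧ e.2 ≠ f.2 ∧ e.2.1 * e.1 + e.2.2 = f.2.1 * e.1 + f.2.2

/-- The flag graph of the affine plane. -/
def flagGraph (q : ℕ) : SimpleGraph (ZMod q × ZMod q × ZMod q) where
  Adj e f := flagRel q e f ∨ flagRel q f e
  symm := ⟨fun _ _ h => h.symm⟩
  loopless := ⟨fun e h => by rcases h with h | h <;> exact lt_irrefl _ h.1⟩

theorem flagRel_no_trans (q : ℕ) [Fact q.Prime] (e f g : ZMod q × ZMod q × ZMod q)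
    (h1 : flagRel q e f) (h2 : flagRel q f g) (h3 : flagRel q e g) : False := by
  obtain ⟨x, a, b⟩ := e
  obtain ⟨x', a', b'⟩ := f
  obtain ⟨x'', a'', b''⟩ := g
  obtain ⟨l1, -, p1⟩ := h1
  obtain ⟨l2, n2, p2⟩ := h2
  obtain ⟨l3, -, p3⟩ := h3
  simp only at *
  have hx : x - x' ≠ 0 := by
    rw [sub_ne_zero]
    rintro rfl
    exact lt_irrefl _ l1
  have : (x - x') * (a' - a'') = 0 := by linear_combination p3 - p1 - p2
  have ha : a' = a'' := sub_eq_zero.1 ((mul_eq_zero.1 this).resolve_left hx)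
  subst ha
  exact n2 (Prod.ext rfl (by simpa using p2))

theorem flagGraph_noTriangle (q : ℕ) [Fact q.Prime] (e f g : ZMod q × ZMod q × ZMod q)
    (h1 : (flagGraph q).Adj e f) (h2 : (flagGraph q).Adj f g) (h3 : (flagGraph q).Adj e g) :
    False := by
  have T := flagRel_no_trans q
  rcases h1 with h1 | h1 <;> rcases h2 with h2 | h2 <;> rcases h3 with h3 | h3
  · exact T _ _ _ h1 h2 h3
  · have := h1.1; have := h2.1; have := h3.1; omega
  · exact T _ _ _ h3 h2 h1
  · exact T _ _ _ h3 h1 h2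
  · exact T _ _ _ h1 h3 h2
  · exact T _ _ _ h2 h3 h1
  · have := h1.1; have := h2.1; have := h3.1; omega
  · exact T _ _ _ h2 h1 h3

open Classical in
theorem flagGraph_indep (q : ℕ) [Fact q.Prime] (I : Finset (ZMod q × ZMod q × ZMod q))
    (hI : IndepFin (flagGraph q) I) : I.card ≤ 2 * q ^ 2 := by
  let Q : ZMod q × ZMod q × ZMod q → Prop := fun e => ∃ f ∈ I, f.2 = e.2 ∧ e.1.val < f.1.val
  have hsplit : (I.filter Q).card + (I.filter (fun e => ¬ Q e)).card = I.card :=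
    Finset.card_filter_add_card_filter_not _
  have hc : (Finset.univ : Finset (ZMod q × ZMod q)).card = q ^ 2 := by
    rw [Finset.card_univ, Fintype.card_prod, ZMod.card, sq]
  have h1 : (I.filter (fun e => ¬ Q e)).card ≤ q ^ 2 := by
    rw [← hc]
    apply Finset.card_le_card_of_injOn Prod.snd (by simp)
    intro e he f hf hef
    obtain ⟨heI, he⟩ := Finset.mem_filter.1 he
    obtain ⟨hfI, hf⟩ := Finset.mem_filter.1 hf
    refine Prod.ext (ZMod.val_injective q ?_) hef
    rcases lt_trichotomy e.1.val f.1.val with h | h | h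
    · exact absurd ⟨f, hfI, hef.symm, h⟩ he
    · exact h
    · exact absurd ⟨e, heI, hef, h⟩ hf
  have h2 : (I.filter Q).card ≤ q ^ 2 := by
    rw [← hc]
    apply Finset.card_le_card_of_injOn
      (fun e : ZMod q × ZMod q × ZMod q => (e.1, e.2.1 * e.1 + e.2.2)) (by simp)
    intro e he f hf hef
    obtain ⟨heI, he⟩ := Finset.mem_filter.1 he
    obtain ⟨hfI, g, hgI, hg, hlt⟩ := Finset.mem_filter.1 hf
    simp only [Prod.mk.injEq] at hef
    obtain ⟨hx, hy⟩ := hef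
    refine Prod.ext hx ?_
    by_contra hne
    refine hI e heI g hgI (Or.inl ⟨by rw [hx]; exact hlt, by rw [hg]; exact hne, ?_⟩)
    rw [hg, hy, hx]
  omega

theorem exists_triangleFree_chromatic_eq_fracChromatic :
    ∃ C : ℝ, ∀ m : ℕ, 0 < m →
      ∃ (n : ℕ) (H : SimpleGraph (Fin n)),
        H.CliqueFree 3 ∧
        (n : ℝ) ≤ C * (m : ℝ) ^ 4 * (1 + Real.log m) ^ 2 ∧
        H.chromaticNumber = m ∧
        fracChrom H = (m : ℝ) := by
  classical
  refine ⟨64, fun m hm => ?_⟩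
  obtain ⟨q, hq, hlt, hle⟩ := Nat.exists_prime_lt_and_le_two_mul (2 * m) (by omega)
  haveI : Fact q.Prime := ⟨hq⟩
  have hcardV : Fintype.card (ZMod q × ZMod q × ZMod q) = q ^ 3 := by
    rw [Fintype.card_prod, Fintype.card_prod, ZMod.card]; ring
  obtain ⟨W, hWn, hW⟩ := exists_expanding (flagGraph q) m (by
    intro A hA
    have := flagGraph_indep q A hA
    rw [hcardV]
    calc m * A.card ≤ m * (2 * q ^ 2) := Nat.mul_le_mul_left _ this
      _ = (2 * m) * q ^ 2 := by ring
      _ ≤ q * q ^ 2 := Nat.mul_le_mul_right _ hlt.le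
      _ = q ^ 3 := by ring)
  let T : Finset ((ZMod q × ZMod q × ZMod q) × Fin m) := W ×ˢ Finset.univ
  have hT : T.card = W.card * m := by simp [T]
  let φ : Fin T.card ↪ (ZMod q × ZMod q × ZMod q) × Fin m :=
    T.equivFin.symm.toEmbedding.trans (Function.Embedding.subtype _)
  have hφ : ∀ i, φ i ∈ T := fun i => (T.equivFin.symm i).2
  let H : SimpleGraph (Fin T.card) := (tensorK (flagGraph q) m).comap φ
  have hpos : 0 < T.card := by
    rw [hT]; exact Nat.mul_pos hWn.card_pos hm
  have hcol : H.Colorable m := by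
    refine ⟨SimpleGraph.Coloring.mk (fun i => (φ i).2) ?_⟩
    intro i j hij
    exact hij.2
  have hind : ∀ S : Finset (Fin T.card), IndepFin H S → m * S.card ≤ T.card := by
    intro S hS
    have := tensor_indep (flagGraph q) m W hW (S.map φ) (by
      intro p hp
      obtain ⟨i, -, rfl⟩ := Finset.mem_map.1 hp
      exact (Finset.mem_product.1 (hφ i)).1) (by
      intro x hx y hy hxy
      obtain ⟨i, hi, rfl⟩ := Finset.mem_map.1 hx
      obtain ⟨j, hj, rfl⟩ := Finset.mem_map.1 hy
      exact hS i hi j hj hxy)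
    rw [Finset.card_map] at this
    exact ((mul_comm _ _).le.trans (Nat.mul_le_mul_right m this)).trans hT.ge
  refine ⟨T.card, H, ?_, ?_, finish hpos H hind hcol⟩
  · intro s hs
    obtain ⟨a, b, c, hab, hac, hbc, -⟩ := SimpleGraph.is3Clique_iff.1 hs
    exact flagGraph_noTriangle q _ _ _ hab.1 hbc.1 hac.1
  · have h1 : T.card ≤ 64 * m ^ 4 := by
      have hWc : W.card ≤ q ^ 3 := by rw [← hcardV]; exact Finset.card_le_univ W
      have hq3 : q ^ 3 ≤ (4 * m) ^ 3 := Nat.pow_le_pow_left (by omega) 3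
      calc T.card = W.card * m := hT
        _ ≤ (4 * m) ^ 3 * m := Nat.mul_le_mul_right _ (hWc.trans hq3)
        _ = 64 * m ^ 4 := by ring
    have h2 : (T.card : ℝ) ≤ 64 * (m : ℝ) ^ 4 := by exact_mod_cast h1
    have hlog : 0 ≤ Real.log m := Real.log_natCast_nonneg m
    have h3 : (1 : ℝ) ≤ (1 + Real.log m) ^ 2 := by nlinarith
    exact h2.trans (le_mul_of_one_le_right (by positivity) h3)
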